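/- Suppose 𝒜 is essential and simplicial. Then for any two regions R, R′ of 𝒜, the join of R and R′ in the facial weak order FW(𝒜,B) is again a region, and the meet of R and R′ in FW(𝒜,B) is again a region; consequently the lattice of regions PR(𝒜,B) is a sublattice of FW(𝒜,B), i.e. joins and meets of regions computed in PR(𝒜,B) agree with those computed in FW(𝒜,B). -/

import Mathlib

open scoped RealInnerProductSpace Pointwise

variable {V : Type*} [NormedAddCommGroup V] [InnerProductSpace ℝ V] [FiniteDimensional ℝ V]
  {ι : Type*} [Fintype ι]

/-- The (open) complement of the union of the hyperplanes with chosen normals `e i`. -/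
def arrComplement (e : ι → V) : Set V := {v | ∀ i, ⟪e i, v⟫ ≠ 0}

/-- A region of the arrangement: the closure of a connected component of the complement
of the union of the hyperplanes. -/
def IsRegion (e : ι → V) (R : Set V) : Prop :=
  ∃ x ∈ arrComplement e, R = closure (connectedComponentIn (arrComplement e) x)

/-- The positive closed half-space bounded by the hyperplane with normal `e i`. -/
def posHalf (e : ι → V) (i : ι) : Set V := {v | 0 ≤ ⟪e i, v⟫}

/-- The negative closed half-space bounded by the hyperplane with normal `e i`. -/
def negHalf (e : ι → V) (i : ι) : Set V := {v | ⟪e i, v⟫ ≤ 0}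

/-- The separation set of two regions: the (indices of) hyperplanes such that the two
regions lie in opposite closed half-spaces. -/
def sepSet (e : ι → V) (R R' : Set V) : Set ι :=
  {i | (R ⊆ posHalf e i ∧ R' ⊆ negHalf e i) ∨ (R ⊆ negHalf e i ∧ R' ⊆ posHalf e i)}

/-- The order of the poset of regions `PR(𝒜,B)`. -/
def PRle (e : ι → V) (B R R' : Set V) : Prop := sepSet e B R ⊆ sepSet e B R'

/-- Strict order of the poset of regions. -/
def PRlt (e : ι → V) (B R R' : Set V) : Prop := PRle e B R R' ∧ R ≠ R'

/-- Cover relation in the poset of regions. -/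
def PRcover (e : ι → V) (B R R' : Set V) : Prop :=
  PRlt e B R R' ∧ ¬ ∃ U, IsRegion e U ∧ PRlt e B R U ∧ PRlt e B U R'

/-- A face of the arrangement: an intersection of a nonempty collection of regions. -/
def IsFace (e : ι → V) (F : Set V) : Prop :=
  ∃ Rs : Set (Set V), Rs.Nonempty ∧ (∀ R ∈ Rs, IsRegion e R) ∧ F = ⋂₀ Rs

/-- `[m, M]` is the facial interval of the face `F` in the poset of regions:
the regions containing `F` are exactly those between `m` and `M`. -/
def IsFacialInterval (e : ι → V) (B F m M : Set V) : Prop :=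
  IsRegion e m ∧ IsRegion e M ∧
    ∀ R, IsRegion e R → (F ⊆ R ↔ (PRle e B m R ∧ PRle e B R M))

/-- The facial weak order `FW(𝒜,B)`: `F ≤ G` iff `m_F ≤ m_G` and `M_F ≤ M_G`
in the poset of regions. -/
def FWle (e : ι → V) (B F G : Set V) : Prop :=
  ∃ mF MF mG MG, IsFacialInterval e B F mF MF ∧ IsFacialInterval e B G mG MG ∧
    PRle e B mF mG ∧ PRle e B MF MG

/-- Strict facial weak order. -/
def FWlt (e : ι → V) (B F G : Set V) : Prop := FWle e B F G ∧ F ≠ G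

/-- Cover relation in the facial weak order. -/
def FWcover (e : ι → V) (B F G : Set V) : Prop :=
  FWlt e B F G ∧ ¬ ∃ X, IsFace e X ∧ FWlt e B F X ∧ FWlt e B X G

/-- Two faces have the same maximal region `M` of their facial intervals. -/
def SameMax (e : ι → V) (B F G : Set V) : Prop :=
  ∃ m m' M, IsFacialInterval e B F m M ∧ IsFacialInterval e B G m' M

/-- Two faces have the same minimal region `m` of their facial intervals. -/
def SameMin (e : ι → V) (B F G : Set V) : Prop :=
  ∃ m M M', IsFacialInterval e B F m M ∧ IsFacialInterval e B G m M'

/-- The dimension of a face: the dimension of its linear span. -/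
noncomputable def fdim (F : Set V) : ℕ := Module.finrank ℝ (Submodule.span ℝ F)

open Classical in
/-- The covector (sign vector) of a face: the sign of `⟪e i, x⟫` for `x` in the
relative interior of the face. -/
noncomputable def covec (e : ι → V) (F : Set V) (i : ι) : SignType :=
  if ∀ x ∈ intrinsicInterior ℝ F, 0 < ⟪e i, x⟫ then 1
  else if ∀ x ∈ intrinsicInterior ℝ F, ⟪e i, x⟫ < 0 then -1
  else 0

/-- Composition of sign vectors. -/
def scomp (f g : ι → SignType) (i : ι) : SignType := if f i ≠ 0 then f i else g i

/-- The set of roots of the arrangement: the chosen normals and their opposites. -/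
def roots (e : ι → V) : Set V := Set.range e ∪ Set.range (fun i => -(e i))

/-- The root inversion set of a face. -/
def rootInv (e : ι → V) (F : Set V) : Set V :=
  {v ∈ roots e | ∃ x ∈ intrinsicInterior ℝ F, ⟪x, v⟫ ≤ 0}

/-- `H i` is a wall of the region `R`. -/
noncomputable def IsWall (e : ι → V) (R : Set V) (i : ι) : Prop :=
  fdim ({v : V | ⟪e i, v⟫ = 0} ∩ R) = Module.finrank ℝ V - 1

/-- A region is simplicial when the normal vectors of its walls are linearly independent. -/
def IsSimplicialRegion (e : ι → V) (R : Set V) : Prop :=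
  LinearIndependent ℝ (fun i : {i : ι // IsWall e R i} => e i.1)

/-- The arrangement is simplicial when all its regions are. -/
def IsSimplicial (e : ι → V) : Prop := ∀ R, IsRegion e R → IsSimplicialRegion e R

/-- The arrangement is essential when the intersection of all its hyperplanes is `{0}`. -/
def IsEssential (e : ι → V) : Prop := (⋂ i, {v : V | ⟪e i, v⟫ = 0}) = ({0} : Set V)

/-- The poset of regions is a lattice: any two regions have a join and a meet. -/
def PRIsLattice (e : ι → V) (B : Set V) : Prop :=
  ∀ R R', IsRegion e R → IsRegion e R' →
    (∃ J, IsRegion e J ∧ PRle e B R J ∧ PRle e B R' J ∧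
      ∀ U, IsRegion e U → PRle e B R U → PRle e B R' U → PRle e B J U) ∧
    (∃ M, IsRegion e M ∧ PRle e B M R ∧ PRle e B M R' ∧
      ∀ U, IsRegion e U → PRle e B U R → PRle e B U R' → PRle e B U M)

set_option linter.unusedSectionVars false

/-- The closed cone of vectors lying weakly on the same side as `x` of every hyperplane. -/
def weakCone (e : ι → V) (x : V) : Set V := {v | ∀ i, 0 ≤ ⟪e i, x⟫ * ⟪e i, v⟫}

/-- The set of (indices of) hyperplanes having `x` strictly on their negative side. -/
def negSet (e : ι → V) (x : V) : Set ι := {i | ⟪e i, x⟫ < 0}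

/-- The negative sets of all the vectors off the hyperplanes. -/
def negSets (e : ι → V) : Set (Set ι) := Set.image (negSet e) (arrComplement e)

lemma connectedComponentIn_arrComplement (e : ι → V) {x : V} (hx : x ∈ arrComplement e) :
    connectedComponentIn (arrComplement e) x = {v | ∀ i, 0 < ⟪e i, x⟫ * ⟪e i, v⟫} := by
  apply Set.Subset.antisymm
  · intro y hy i
    by_contra! h
    have hc : ContinuousOn (fun v => ⟪e i, x⟫ * ⟪e i, v⟫)
        (connectedComponentIn (arrComplement e) x) := by fun_prop
    obtain ⟨w, hw, hw0⟩ := isPreconnected_connectedComponentIn.intermediate_value hy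
      (mem_connectedComponentIn hx) hc ⟨h, (mul_self_pos.2 (hx i)).le⟩
    rcases mul_eq_zero.1 hw0 with h0 | h0
    · exact hx i h0
    · exact connectedComponentIn_subset _ _ hw i h0
  · have hconv : Convex ℝ {v | ∀ i, 0 < ⟪e i, x⟫ * ⟪e i, v⟫} := by
      intro u hu v hv a b ha hb hab i
      have h : ⟪e i, x⟫ * ⟪e i, a • u + b • v⟫
          = a * (⟪e i, x⟫ * ⟪e i, u⟫) + b * (⟪e i, x⟫ * ⟪e i, v⟫) := by
        simp only [inner_add_right, inner_smul_right]; ring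
      rw [h]
      rcases ha.eq_or_lt with rfl | ha
      · obtain rfl : b = 1 := by linarith
        simpa using hv i
      · have := mul_pos ha (hu i)
        have := mul_nonneg hb (hv i).le
        linarith
    refine hconv.isPreconnected.subset_connectedComponentIn
      (fun i => mul_self_pos.2 (hx i)) fun v hv i h0 => ?_
    have := hv i
    simp [h0] at this

lemma closure_connectedComponentIn_arrComplement (e : ι → V) {x : V}
    (hx : x ∈ arrComplement e) :
    closure (connectedComponentIn (arrComplement e) x) = weakCone e x := by
  rw [connectedComponentIn_arrComplement e hx]
  apply Set.Subset.antisymm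
  · refine closure_minimal (fun v hv i => (hv i).le) ?_
    simp only [weakCone, Set.ofPred_forall]
    exact isClosed_iInter fun i => isClosed_le continuous_const (by fun_prop)
  · intro v hv
    have ht : Filter.Tendsto (fun t : ℝ => v + t • x) (nhdsWithin 0 (Set.Ioi 0)) (nhds v) := by
      have : Continuous fun t : ℝ => v + t • x := by fun_prop
      simpa using (this.tendsto 0).mono_left nhdsWithin_le_nhds
    refine mem_closure_of_tendsto ht ?_
    filter_upwards [self_mem_nhdsWithin] with t (ht : 0 < t) i
    have h1 := mul_pos ht (mul_self_pos.2 (hx i))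
    have h2 := hv i
    simp only [inner_add_right, inner_smul_right]
    linarith

lemma isRegion_iff (e : ι → V) (R : Set V) :
    IsRegion e R ↔ ∃ x ∈ arrComplement e, R = weakCone e x := by
  constructor <;> rintro ⟨x, hx, rfl⟩ <;>
    exact ⟨x, hx, by rw [closure_connectedComponentIn_arrComplement e hx]⟩

lemma self_mem_weakCone (e : ι → V) (x : V) : x ∈ weakCone e x :=
  fun _ => mul_self_nonneg _

lemma negSet_eq_of_mem_weakCone (e : ι → V) {x y : V} (hx : x ∈ arrComplement e)
    (hy : y ∈ arrComplement e) (h : y ∈ weakCone e x) : negSet e y = negSet e x := by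
  ext i
  have h1 := h i
  have h2 := hx i
  have h3 := hy i
  simp only [negSet, Set.mem_ofPred_eq]
  constructor <;> intro h4 <;> by_contra! h5
  · exact absurd (mul_neg_of_pos_of_neg (h5.lt_of_ne' h2) h4) h1.not_gt
  · exact absurd (mul_neg_of_neg_of_pos h4 (h5.lt_of_ne' h3)) h1.not_gt

lemma weakCone_eq_of_negSet_eq (e : ι → V) {x y : V} (hx : x ∈ arrComplement e)
    (hy : y ∈ arrComplement e) (h : negSet e x = negSet e y) :
    weakCone e x = weakCone e y := by
  have key : ∀ i, 0 < ⟪e i, x⟫ * ⟪e i, y⟫ := by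
    intro i
    have hi : ⟪e i, x⟫ < 0 ↔ ⟪e i, y⟫ < 0 := Set.ext_iff.1 h i
    rcases (hx i).lt_or_gt with h1 | h1
    · exact mul_pos_of_neg_of_neg h1 (hi.1 h1)
    · exact mul_pos h1 ((not_lt.1 (mt hi.2 h1.not_gt)).lt_of_ne' (hy i))
  ext v
  refine forall_congr' fun i => ?_
  rcases pos_and_pos_or_neg_and_neg_of_mul_pos (key i) with ⟨h1, h2⟩ | ⟨h1, h2⟩
  · rw [mul_nonneg_iff_of_pos_left h1, mul_nonneg_iff_of_pos_left h2]
  · rw [← neg_mul_neg, mul_nonneg_iff_of_pos_left (neg_pos.2 h1), ← neg_mul_neg ⟪e i, y⟫,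
      mul_nonneg_iff_of_pos_left (neg_pos.2 h2)]

lemma sepSet_weakCone (e : ι → V) {B : Set V} (hB : IsRegion e B)
    (hBpos : ∀ i, B ⊆ posHalf e i) {x : V} (hx : x ∈ arrComplement e) :
    sepSet e B (weakCone e x) = negSet e x := by
  obtain ⟨b, hb, rfl⟩ := (isRegion_iff e B).1 hB
  ext i
  constructor
  · rintro (⟨-, h⟩ | ⟨h, -⟩)
    · exact lt_of_le_of_ne (h (self_mem_weakCone e x)) (hx i)
    · exact absurd (le_antisymm (h (self_mem_weakCone e b))
        (hBpos i (self_mem_weakCone e b))) (hb i)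
  · intro h
    refine Or.inl ⟨hBpos i, fun v hv => ?_⟩
    by_contra! hneg
    exact absurd (mul_neg_of_neg_of_pos h (not_le.1 hneg)) (hv i).not_gt

/-- Vectors pairing in a prescribed way with a linearly independent family. -/
lemma exists_inner_eq_of_linearIndependent {κ : Type*} {f : κ → V}
    (hf : LinearIndependent ℝ f) (c : κ → ℝ) : ∃ p : V, ∀ k, ⟪f k, p⟫ = c k := by
  obtain ⟨φ, hφ⟩ : ∃ φ : V →ₗ[ℝ] ℝ, ∀ k, φ (f k) = c k := by
    obtain ⟨φ, hφ⟩ := ((Module.Basis.span hf).constr ℝ c).exists_extend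
    refine ⟨φ, fun k => ?_⟩
    have h := LinearMap.congr_fun hφ (Module.Basis.span hf k)
    rw [Module.Basis.constr_basis] at h
    rw [← h, LinearMap.comp_apply, Submodule.subtype_apply, Module.Basis.span_apply]
  refine ⟨(InnerProductSpace.toDual ℝ V).symm (LinearMap.toContinuousLinearMap φ), fun k => ?_⟩
  rw [real_inner_comm, InnerProductSpace.toDual_symm_apply]
  exact hφ k

/-- A hyperplane `H j` is a wall of the region of `x` as soon as it can be crossed without
violating the other inequalities of a system defining that region. -/
lemma isWall_of_exists_violating (e : ι → V) (hne : ∀ i, e i ≠ 0) {x : V}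
    (hx : x ∈ arrComplement e) {W : Finset ι} {j : ι}
    (hW : ∀ v, (∀ k ∈ W, 0 ≤ ⟪e k, x⟫ * ⟪e k, v⟫) → v ∈ weakCone e x) {y : V}
    (hy : ∀ k ∈ W, k ≠ j → 0 ≤ ⟪e k, x⟫ * ⟪e k, y⟫) (hyj : ⟪e j, x⟫ * ⟪e j, y⟫ < 0) :
    IsWall e (weakCone e x) j := by
  have hpos : ∀ i, 0 < ⟪e i, x⟫ * ⟪e i, x⟫ := fun i => mul_self_pos.2 (hx i)
  set z : V := (-(⟪e j, x⟫ * ⟪e j, y⟫)) • x + (⟪e j, x⟫ * ⟪e j, x⟫) • y with hz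
  have hzj : ⟪e j, z⟫ = 0 := by
    simp only [hz, inner_add_right, inner_smul_right]; ring
  have hzk : ∀ k ∈ W, k ≠ j → 0 < ⟪e k, x⟫ * ⟪e k, z⟫ := by
    intro k hk hkj
    have h1 := mul_pos (neg_pos.2 hyj) (hpos k)
    have h2 := mul_nonneg (hpos j).le (hy k hk hkj)
    simp only [hz, inner_add_right, inner_smul_right]
    linarith
  have hspan : Submodule.span ℝ ({v : V | ⟪e j, v⟫ = 0} ∩ weakCone e x)
      = (Submodule.span ℝ {e j})ᗮ := by
    apply le_antisymm
    · rw [Submodule.span_le]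
      rintro v ⟨hv, -⟩
      exact Submodule.mem_orthogonal_singleton_iff_inner_right.2 hv
    · intro v hv
      have hvj : ⟪e j, v⟫ = 0 := Submodule.mem_orthogonal_singleton_iff_inner_right.1 hv
      have hev : ∀ᶠ t : ℝ in nhdsWithin 0 (Set.Ioi 0),
          ∀ k ∈ W, 0 ≤ ⟪e k, x⟫ * ⟪e k, z + t • v⟫ := by
        rw [Filter.eventually_all_finset]
        intro k hk
        by_cases hkj : k = j
        · subst hkj
          exact Filter.Eventually.of_forall fun t => by
            simp [inner_add_right, inner_smul_right, hzj, hvj]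
        · have hc : Continuous fun t : ℝ => ⟪e k, x⟫ * ⟪e k, z + t • v⟫ := by fun_prop
          have h0 : 0 < ⟪e k, x⟫ * ⟪e k, z + (0 : ℝ) • v⟫ := by simpa using hzk k hk hkj
          exact (((hc.tendsto 0).eventually_const_lt h0).filter_mono nhdsWithin_le_nhds).mono
            fun t ht => ht.le
      obtain ⟨t, ht, ht0⟩ := (hev.and self_mem_nhdsWithin).exists
      have h1 : z + t • v ∈ Submodule.span ℝ ({v : V | ⟪e j, v⟫ = 0} ∩ weakCone e x) :=
        Submodule.subset_span
          ⟨by simp [inner_add_right, inner_smul_right, hzj, hvj], hW _ ht⟩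
      have h2 : z ∈ Submodule.span ℝ ({v : V | ⟪e j, v⟫ = 0} ∩ weakCone e x) := by
        refine Submodule.subset_span ⟨hzj, hW _ fun k hk => ?_⟩
        by_cases hkj : k = j
        · subst hkj; simp [hzj]
        · exact (hzk k hk hkj).le
      have h3 := Submodule.sub_mem _ h1 h2
      rw [add_sub_cancel_left] at h3
      exact (Submodule.smul_mem_iff _ (ne_of_gt ht0)).1 h3
  have h1 := (Submodule.span ℝ {e j}).finrank_add_finrank_orthogonal
  rw [finrank_span_singleton (hne j)] at h1
  rw [IsWall, fdim, hspan]
  omega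

/-- A simplicial region is cut out by linearly independent inequalities. -/
lemma exists_linearIndependent_defining (e : ι → V) (hne : ∀ i, e i ≠ 0) {x : V}
    (hx : x ∈ arrComplement e) (hs : IsSimplicialRegion e (weakCone e x)) :
    ∃ W : Finset ι, LinearIndependent ℝ (fun k : W => e k) ∧
      ∀ v, (∀ k ∈ W, 0 ≤ ⟪e k, x⟫ * ⟪e k, v⟫) → v ∈ weakCone e x := by
  classical
  obtain ⟨W, hW⟩ := (Set.toFinite {W : Finset ι |
    ∀ v, (∀ k ∈ W, 0 ≤ ⟪e k, x⟫ * ⟪e k, v⟫) → v ∈ weakCone e x}).exists_minimal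
      ⟨Finset.univ, fun v hv i => hv i (Finset.mem_univ i)⟩
  refine ⟨W, ?_, hW.prop⟩
  have hwall : ∀ j ∈ W, IsWall e (weakCone e x) j := by
    intro j hj
    have hnot := hW.not_prop_of_lt (Finset.erase_ssubset hj)
    simp only [Set.mem_ofPred_eq, not_forall] at hnot
    obtain ⟨y, hy, hyn⟩ := hnot
    refine isWall_of_exists_violating e hne hx hW.prop
      (fun k hk hkj => hy k (Finset.mem_erase.2 ⟨hkj, hk⟩)) ?_
    by_contra! hcon
    refine hyn (hW.prop y fun k hk => ?_)
    by_cases hkj : k = j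
    · exact hkj ▸ hcon
    · exact hy k (Finset.mem_erase.2 ⟨hkj, hk⟩)
  exact hs.comp (fun k : W => ⟨k.1, hwall k.1 k.2⟩)
    fun a b h => Subtype.ext (congrArg (fun t => t.1) h)

/-- Above a region and any set `K` of its upper walls there is a least region separated from
the base region by all the hyperplanes in `K`. -/
lemma exists_least_negSet (e : ι → V) {b z : V} (hb : ∀ i, 0 < ⟪e i, b⟫)
    (hz : z ∈ arrComplement e) {W : Finset ι}
    (hli : LinearIndependent ℝ (fun k : W => e k))
    (hW : ∀ v, (∀ k ∈ W, 0 ≤ ⟪e k, z⟫ * ⟪e k, v⟫) → v ∈ weakCone e z)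
    {K : Set ι} (hKW : ∀ k ∈ K, k ∈ W) (hKz : ∀ k ∈ K, k ∉ negSet e z) :
    ∃ m ∈ arrComplement e, negSet e z ⊆ negSet e m ∧ K ⊆ negSet e m ∧
      ∀ u ∈ arrComplement e, negSet e z ⊆ negSet e u → K ⊆ negSet e u →
        negSet e m ⊆ negSet e u := by
  classical
  have hzpos : ∀ i, i ∉ negSet e z → 0 < ⟪e i, z⟫ :=
    fun i hi => (not_lt.1 hi).lt_of_ne' (hz i)
  obtain ⟨p, hp⟩ := exists_inner_eq_of_linearIndependent hli
    (fun k => if k.1 ∈ K then 0 else ⟪e k, z⟫)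
  have hpK : ∀ k ∈ K, ⟪e k, p⟫ = 0 := fun k hk => by
    simpa [hk] using hp ⟨k, hKW k hk⟩
  have hpW : ∀ k ∈ W, k ∉ K → ⟪e k, p⟫ = ⟪e k, z⟫ := fun k hk hkK => by
    simpa [hkK] using hp ⟨k, hk⟩
  have hpz : p ∈ weakCone e z := by
    refine hW p fun k hk => ?_
    by_cases hkK : k ∈ K
    · simp [hpK k hkK]
    · rw [hpW k hk hkK]; exact mul_self_nonneg _
  obtain ⟨t, ht, ht0⟩ : ∃ t : ℝ, (∀ i, 0 < ⟪e i, p⟫ → 0 < ⟪e i, p - t • b⟫) ∧ 0 < t := by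
    have hev : ∀ᶠ t : ℝ in nhdsWithin 0 (Set.Ioi 0),
        ∀ i, 0 < ⟪e i, p⟫ → 0 < ⟪e i, p - t • b⟫ := by
      rw [Filter.eventually_all]
      intro i
      by_cases hi : 0 < ⟪e i, p⟫
      · have hc : Continuous fun t : ℝ => ⟪e i, p - t • b⟫ := by fun_prop
        have h0 : 0 < ⟪e i, p - (0 : ℝ) • b⟫ := by simpa using hi
        exact (((hc.tendsto 0).eventually_const_lt h0).filter_mono nhdsWithin_le_nhds).mono
          fun t ht _ => ht
      · exact Filter.Eventually.of_forall fun t h => absurd h hi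
    exact (hev.and self_mem_nhdsWithin).exists
  have hneg : ∀ i, ⟪e i, p⟫ ≤ 0 → ⟪e i, p - t • b⟫ < 0 := by
    intro i hi
    have := mul_pos ht0 (hb i)
    rw [inner_sub_right, inner_smul_right]
    linarith
  refine ⟨p - t • b, fun i => ?_, fun i hi => ?_, fun k hk => hneg k (hpK k hk).le, ?_⟩
  · rcases lt_or_ge 0 ⟪e i, p⟫ with h | h
    · exact (ht i h).ne'
    · exact (hneg i h).ne
  · refine hneg i ?_
    by_contra! h
    exact absurd (mul_neg_of_neg_of_pos hi h) (hpz i).not_gt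
  · intro u hu hzu hKu i hi
    by_cases hiz : i ∈ negSet e z
    · exact hzu hiz
    have hip : ⟪e i, p⟫ = 0 := by
      refine le_antisymm ?_ ((mul_nonneg_iff_of_pos_left (hzpos i hiz)).1 (hpz i))
      by_contra! h
      exact absurd hi (ht i h).not_gt
    obtain ⟨N, hN⟩ : ∃ N : ℝ, ∀ k, ⟪e k, z⟫ * ⟪e k, u⟫ ≤ N * (⟪e k, z⟫ * ⟪e k, z⟫) := by
      have hev : ∀ᶠ N : ℝ in Filter.atTop,
          ∀ k, ⟪e k, z⟫ * ⟪e k, u⟫ ≤ N * (⟪e k, z⟫ * ⟪e k, z⟫) := by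
        rw [Filter.eventually_all]
        exact fun k => (Filter.tendsto_id.atTop_mul_const
          (mul_self_pos.2 (hz k))).eventually_ge_atTop _
      exact hev.exists
    have hmem : N • p - u ∈ weakCone e z := by
      refine hW _ fun k hk => ?_
      rw [inner_sub_right, inner_smul_right]
      by_cases hkK : k ∈ K
      · have h1 : ⟪e k, u⟫ < 0 := hKu hkK
        have h2 := mul_pos (hzpos k (hKz k hkK)) (neg_pos.2 h1)
        rw [hpK k hkK]
        linarith
      · rw [hpW k hk hkK]
        linarith [hN k]
    have h1 := (mul_nonneg_iff_of_pos_left (hzpos i hiz)).1 (hmem i)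
    rw [inner_sub_right, inner_smul_right, hip] at h1
    exact lt_of_le_of_ne (by linarith) (hu i)

/-- A finite family of sets ordered by inclusion has a join for any two members with a common
lower bound, provided it has joins of suitable elements just above any member. -/
lemma exists_join_of_local_joins {α : Type*} [Finite α] (L : Set (Set α))
    (hL : ∀ Z ∈ L, ∀ X ∈ L, ∀ Y ∈ L, Z ⊂ X → Z ⊂ Y →
      ∃ X' ∈ L, ∃ Y' ∈ L, ∃ M ∈ L, Z ⊂ X' ∧ X' ⊆ X ∧ Z ⊂ Y' ∧ Y' ⊆ Y ∧ X' ⊆ M ∧ Y' ⊆ M ∧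
        ∀ U ∈ L, X' ⊆ U → Y' ⊆ U → M ⊆ U)
    {Z X Y : Set α} (hZ : Z ∈ L) (hX : X ∈ L) (hY : Y ∈ L) (hZX : Z ⊆ X) (hZY : Z ⊆ Y) :
    ∃ J ∈ L, X ⊆ J ∧ Y ⊆ J ∧ ∀ U ∈ L, X ⊆ U → Y ⊆ U → J ⊆ U := by
  induction Z using (wellFounded_gt (α := Set α)).induction generalizing X Y with
  | _ Z ih =>
    rcases hZX.eq_or_ssubset with rfl | hZX
    · exact ⟨Y, hY, hZY, subset_rfl, fun _ _ _ h => h⟩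
    rcases hZY.eq_or_ssubset with rfl | hZY
    · exact ⟨X, hX, subset_rfl, hZX.subset, fun _ _ h _ => h⟩
    obtain ⟨X', hX', Y', hY', M, hM, hZX', hXX', hZY', hYY', hXM, hYM, hMin⟩ :=
      hL Z hZ X hX Y hY hZX hZY
    obtain ⟨N, hN, hXN, hMN, hNmin⟩ := ih X' hZX' hX' hX hM hXX' hXM
    obtain ⟨J, hJ, hYJ, hNJ, hJmin⟩ := ih Y' hZY' hY' hY hN hYY' (hYM.trans hMN)
    exact ⟨J, hJ, hXN.trans hNJ, hYJ, fun U hU hXU hYU => hJmin U hU hYU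
      (hNmin U hU hXU (hMin U hU (hXX'.trans hXU) (hYY'.trans hYU)))⟩

lemma exists_mem_of_negSet_ssubset (e : ι → V) {z x : V} (hz : z ∈ arrComplement e)
    (hx : x ∈ arrComplement e) {W : Finset ι}
    (hW : ∀ v, (∀ k ∈ W, 0 ≤ ⟪e k, z⟫ * ⟪e k, v⟫) → v ∈ weakCone e z)
    (h : negSet e z ⊂ negSet e x) : ∃ k ∈ W, k ∉ negSet e z ∧ k ∈ negSet e x := by
  by_contra! hcon
  refine h.ne (negSet_eq_of_mem_weakCone e hz hx (hW x fun k hk => ?_)).symm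
  by_cases hkz : k ∈ negSet e z
  · exact (mul_pos_of_neg_of_neg hkz (h.subset hkz)).le
  · exact mul_nonneg (not_lt.1 hkz) (not_lt.1 (hcon k hk hkz))

/-- Joins of regions of a simplicial arrangement, in terms of separation sets. -/
lemma exists_join_negSet (e : ι → V) (hne : ∀ i, e i ≠ 0) (hsimp : IsSimplicial e) {b : V}
    (hb : ∀ i, 0 < ⟪e i, b⟫) {x y : V} (hx : x ∈ arrComplement e) (hy : y ∈ arrComplement e) :
    ∃ m ∈ arrComplement e, negSet e x ⊆ negSet e m ∧ negSet e y ⊆ negSet e m ∧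
      ∀ u ∈ arrComplement e, negSet e x ⊆ negSet e u → negSet e y ⊆ negSet e u →
        negSet e m ⊆ negSet e u := by
  have hbneg : negSet e b = ∅ := Set.eq_empty_of_forall_notMem fun i hi => (hb i).not_gt hi
  have hL : ∀ Z ∈ negSets e, ∀ X ∈ negSets e,
      ∀ Y ∈ negSets e, Z ⊂ X → Z ⊂ Y →
      ∃ X' ∈ negSets e, ∃ Y' ∈ negSets e,
      ∃ M ∈ negSets e, Z ⊂ X' ∧ X' ⊆ X ∧ Z ⊂ Y' ∧ Y' ⊆ Y ∧ X' ⊆ M ∧ Y' ⊆ M ∧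
        ∀ U ∈ negSets e, X' ⊆ U → Y' ⊆ U → M ⊆ U := by
    rintro _ ⟨z, hz, rfl⟩ _ ⟨x, hx, rfl⟩ _ ⟨y, hy, rfl⟩ hzx hzy
    obtain ⟨W, hli, hW⟩ := exists_linearIndependent_defining e hne hz
      (hsimp _ ((isRegion_iff e _).2 ⟨z, hz, rfl⟩))
    obtain ⟨i, hiW, hiz, hix⟩ := exists_mem_of_negSet_ssubset e hz hx hW hzx
    obtain ⟨j, hjW, hjz, hjy⟩ := exists_mem_of_negSet_ssubset e hz hy hW hzy
    obtain ⟨x', hx', hzx', hix', hminx⟩ := exists_least_negSet e hb hz hli hW (K := {i})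
      (by simpa using hiW) (by simpa using hiz)
    obtain ⟨y', hy', hzy', hjy', hminy⟩ := exists_least_negSet e hb hz hli hW (K := {j})
      (by simpa using hjW) (by simpa using hjz)
    obtain ⟨m, hm, hzm, hijm, hminm⟩ := exists_least_negSet e hb hz hli hW (K := {i, j})
      (by rintro k (rfl | rfl) <;> assumption) (by rintro k (rfl | rfl) <;> assumption)
    rw [Set.singleton_subset_iff] at hix' hjy'
    rw [Set.pair_subset_iff] at hijm
    refine ⟨_, ⟨x', hx', rfl⟩, _, ⟨y', hy', rfl⟩, _, ⟨m, hm, rfl⟩,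
      ⟨hzx', fun h => hiz (h hix')⟩, hminx x hx hzx.subset (Set.singleton_subset_iff.2 hix),
      ⟨hzy', fun h => hjz (h hjy')⟩, hminy y hy hzy.subset (Set.singleton_subset_iff.2 hjy),
      hminx m hm hzm (Set.singleton_subset_iff.2 hijm.1),
      hminy m hm hzm (Set.singleton_subset_iff.2 hijm.2), ?_⟩
    rintro _ ⟨u, hu, rfl⟩ hxu hyu
    exact hminm u hu (hzx'.trans hxu) (Set.pair_subset_iff.2 ⟨hxu hix', hyu hjy'⟩)
  obtain ⟨_, ⟨m, hm, rfl⟩, hxm, hym, hmin⟩ :=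
    exists_join_of_local_joins (negSets e) (Z := negSet e b) hL
      ⟨b, fun i => (hb i).ne', rfl⟩ ⟨x, hx, rfl⟩ ⟨y, hy, rfl⟩ (by simp [hbneg]) (by simp [hbneg])
  exact ⟨m, hm, hxm, hym, fun u hu => hmin _ ⟨u, hu, rfl⟩⟩

lemma neg_mem_arrComplement (e : ι → V) {x : V} (hx : x ∈ arrComplement e) :
    -x ∈ arrComplement e := fun i => by
  rw [inner_neg_right]
  exact neg_ne_zero.2 (hx i)

lemma negSet_neg (e : ι → V) {x : V} (hx : x ∈ arrComplement e) :
    negSet e (-x) = (negSet e x)ᶜ := by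
  ext i
  simp only [negSet, Set.mem_ofPred_eq, Set.mem_compl_iff, inner_neg_right, neg_lt_zero, not_lt]
  exact ⟨le_of_lt, fun h => h.lt_of_ne' (hx i)⟩

lemma prIsLattice_of_isSimplicial (e : ι → V) (hne : ∀ i, e i ≠ 0) {B : Set V}
    (hB : IsRegion e B) (hBpos : ∀ i, B ⊆ posHalf e i) (hsimp : IsSimplicial e) :
    PRIsLattice e B := by
  obtain ⟨b, hb, hBb⟩ := (isRegion_iff e B).1 hB
  have hbpos : ∀ i, 0 < ⟪e i, b⟫ := fun i =>
    lt_of_le_of_ne (hBpos i (hBb ▸ self_mem_weakCone e b)) (hb i).symm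
  have hle : ∀ {x y}, x ∈ arrComplement e → y ∈ arrComplement e →
      (PRle e B (weakCone e x) (weakCone e y) ↔ negSet e x ⊆ negSet e y) := by
    intro x y hx hy
    rw [PRle, sepSet_weakCone e hB hBpos hx, sepSet_weakCone e hB hBpos hy]
  intro R R' hR hR'
  obtain ⟨x, hx, rfl⟩ := (isRegion_iff e R).1 hR
  obtain ⟨y, hy, rfl⟩ := (isRegion_iff e R').1 hR'
  constructor
  · obtain ⟨m, hm, hxm, hym, hmin⟩ := exists_join_negSet e hne hsimp hbpos hx hy
    refine ⟨weakCone e m, (isRegion_iff e _).2 ⟨m, hm, rfl⟩, (hle hx hm).2 hxm,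
      (hle hy hm).2 hym, fun U hU hxU hyU => ?_⟩
    obtain ⟨u, hu, rfl⟩ := (isRegion_iff e U).1 hU
    exact (hle hm hu).2 (hmin u hu ((hle hx hu).1 hxU) ((hle hy hu).1 hyU))
  · obtain ⟨m, hm, hxm, hym, hmin⟩ := exists_join_negSet e hne hsimp hbpos
      (neg_mem_arrComplement e hx) (neg_mem_arrComplement e hy)
    have hm' := neg_mem_arrComplement e hm
    rw [negSet_neg e hx] at hxm
    rw [negSet_neg e hy] at hym
    refine ⟨weakCone e (-m), (isRegion_iff e _).2 ⟨-m, hm', rfl⟩, (hle hm' hx).2 ?_,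
      (hle hm' hy).2 ?_, fun U hU hxU hyU => ?_⟩
    · rw [negSet_neg e hm]; exact Set.compl_subset_comm.1 hxm
    · rw [negSet_neg e hm]; exact Set.compl_subset_comm.1 hym
    · obtain ⟨u, hu, rfl⟩ := (isRegion_iff e U).1 hU
      have h := hmin (-u) (neg_mem_arrComplement e hu)
        (by rw [negSet_neg e hx, negSet_neg e hu]
            exact Set.compl_subset_compl.2 ((hle hu hx).1 hxU))
        (by rw [negSet_neg e hy, negSet_neg e hu]
            exact Set.compl_subset_compl.2 ((hle hu hy).1 hyU))
      rw [negSet_neg e hu] at h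
      rw [hle hu hm', negSet_neg e hm]
      exact Set.subset_compl_comm.1 h

lemma eq_of_isRegion_of_subset (e : ι → V) {R S : Set V} (hR : IsRegion e R)
    (hS : IsRegion e S) (h : R ⊆ S) : R = S := by
  obtain ⟨x, hx, rfl⟩ := (isRegion_iff e R).1 hR
  obtain ⟨y, hy, rfl⟩ := (isRegion_iff e S).1 hS
  exact weakCone_eq_of_negSet_eq e hx hy
    (negSet_eq_of_mem_weakCone e hy hx (h (self_mem_weakCone e x)))

lemma PRle.antisymm {e : ι → V} {B : Set V} (hB : IsRegion e B)
    (hBpos : ∀ i, B ⊆ posHalf e i) {R S : Set V} (hR : IsRegion e R) (hS : IsRegion e S)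
    (h : PRle e B R S) (h' : PRle e B S R) : R = S := by
  obtain ⟨x, hx, rfl⟩ := (isRegion_iff e R).1 hR
  obtain ⟨y, hy, rfl⟩ := (isRegion_iff e S).1 hS
  refine weakCone_eq_of_negSet_eq e hx hy ?_
  rw [← sepSet_weakCone e hB hBpos hx, ← sepSet_weakCone e hB hBpos hy]
  exact Set.Subset.antisymm h h'

lemma IsFacialInterval.min_le_max {e : ι → V} {B F m M : Set V}
    (h : IsFacialInterval e B F m M) {R : Set V} (hR : IsRegion e R) (hF : F ⊆ R) :
    PRle e B m M :=
  ((h.2.2 R hR).1 hF).1.trans ((h.2.2 R hR).1 hF).2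

lemma IsFace.exists_isRegion_superset {e : ι → V} {F : Set V} (hF : IsFace e F) :
    ∃ R, IsRegion e R ∧ F ⊆ R := by
  obtain ⟨Rs, ⟨R, hR⟩, hRs, rfl⟩ := hF
  exact ⟨R, hRs R hR, Set.sInter_subset_of_mem hR⟩

lemma isFacialInterval_self {e : ι → V} {B : Set V} (hB : IsRegion e B)
    (hBpos : ∀ i, B ⊆ posHalf e i) {R : Set V} (hR : IsRegion e R) :
    IsFacialInterval e B R R R := by
  refine ⟨hR, hR, fun S hS => ⟨fun h => ?_, fun h => ?_⟩⟩
  · obtain rfl := eq_of_isRegion_of_subset e hR hS h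
    exact ⟨subset_rfl, subset_rfl⟩
  · exact (PRle.antisymm hB hBpos hR hS h.1 h.2).subset

lemma IsFacialInterval.eq_of_isRegion {e : ι → V} {B R m M : Set V} (hR : IsRegion e R)
    (h : IsFacialInterval e B R m M) : m = R ∧ M = R := by
  have hmM := h.min_le_max hR subset_rfl
  exact ⟨(eq_of_isRegion_of_subset e hR h.1 ((h.2.2 m h.1).2 ⟨subset_rfl, hmM⟩)).symm,
    (eq_of_isRegion_of_subset e hR h.2.1 ((h.2.2 M h.2.1).2 ⟨hmM, subset_rfl⟩)).symm⟩

lemma fwLe_of_prLe {e : ι → V} {B : Set V} (hB : IsRegion e B)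
    (hBpos : ∀ i, B ⊆ posHalf e i) {R S : Set V} (hR : IsRegion e R) (hS : IsRegion e S)
    (h : PRle e B R S) : FWle e B R S :=
  ⟨R, R, S, S, isFacialInterval_self hB hBpos hR, isFacialInterval_self hB hBpos hS, h, h⟩

/-- The facial interval of a face is unique. -/
lemma IsFacialInterval.unique {e : ι → V} {B F m M m' M' : Set V} (hB : IsRegion e B)
    (hBpos : ∀ i, B ⊆ posHalf e i) (hF : IsFace e F)
    (h : IsFacialInterval e B F m M) (h' : IsFacialInterval e B F m' M') :
    m = m' ∧ M = M' := by
  obtain ⟨R, hR, hFR⟩ := hF.exists_isRegion_superset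
  have hmM := h.min_le_max hR hFR
  have hmM' := h'.min_le_max hR hFR
  have hm := (h'.2.2 m h.1).1 ((h.2.2 m h.1).2 ⟨subset_rfl, hmM⟩)
  have hM := (h'.2.2 M h.2.1).1 ((h.2.2 M h.2.1).2 ⟨hmM, subset_rfl⟩)
  have hm' := (h.2.2 m' h'.1).1 ((h'.2.2 m' h'.1).2 ⟨subset_rfl, hmM'⟩)
  have hM' := (h.2.2 M' h'.2.1).1 ((h'.2.2 M' h'.2.1).2 ⟨hmM', subset_rfl⟩)
  exact ⟨PRle.antisymm hB hBpos h.1 h'.1 hm'.1 hm.1,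
    PRle.antisymm hB hBpos h.2.1 h'.2.1 hM.2 hM'.2⟩

/-- For an essential simplicial arrangement, joins and meets of regions in the facial
weak order are regions and agree with joins and meets in the poset of regions. -/
theorem stmt18 (e : ι → V) (hne : ∀ i, e i ≠ 0) (hess : IsEssential e) (B : Set V)
    (hB : IsRegion e B) (hBpos : ∀ i, B ⊆ posHalf e i)
    (hsimp : IsSimplicial e) :
    ∀ R R', IsRegion e R → IsRegion e R' →
      (∃ J, IsRegion e J ∧
        FWle e B R J ∧ FWle e B R' J ∧
        (∀ U, IsFace e U → FWle e B R U → FWle e B R' U → FWle e B J U) ∧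
        PRle e B R J ∧ PRle e B R' J ∧
        (∀ U, IsRegion e U → PRle e B R U → PRle e B R' U → PRle e B J U)) ∧
      (∃ M, IsRegion e M ∧
        FWle e B M R ∧ FWle e B M R' ∧
        (∀ U, IsFace e U → FWle e B U R → FWle e B U R' → FWle e B U M) ∧
        PRle e B M R ∧ PRle e B M R' ∧
        (∀ U, IsRegion e U → PRle e B U R → PRle e B U R' → PRle e B U M)) := by
  intro R R' hR hR'
  obtain ⟨⟨J, hJ, hRJ, hRJ', hJmin⟩, ⟨M, hM, hRM, hRM', hMmax⟩⟩ :=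
    prIsLattice_of_isSimplicial e hne hB hBpos hsimp R R' hR hR'
  refine ⟨⟨J, hJ, fwLe_of_prLe hB hBpos hR hJ hRJ, fwLe_of_prLe hB hBpos hR' hJ hRJ', ?_,
    hRJ, hRJ', hJmin⟩, ⟨M, hM, fwLe_of_prLe hB hBpos hM hR hRM,
    fwLe_of_prLe hB hBpos hM hR' hRM', ?_, hRM, hRM', hMmax⟩⟩
  · rintro U hU ⟨mR, MR, m, N, hRI, hUI, hm, -⟩ ⟨mR', MR', m', N', hRI', hUI', hm', -⟩
    obtain ⟨rfl, -⟩ := hRI.eq_of_isRegion hR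
    obtain ⟨rfl, -⟩ := hRI'.eq_of_isRegion hR'
    obtain ⟨rfl, -⟩ := hUI.unique hB hBpos hU hUI'
    obtain ⟨S, hS, hUS⟩ := hU.exists_isRegion_superset
    have hJm := hJmin m hUI.1 hm hm'
    exact ⟨J, J, m, N, isFacialInterval_self hB hBpos hJ, hUI, hJm,
      hJm.trans (hUI.min_le_max hS hUS)⟩
  · rintro U hU ⟨m, N, mR, MR, hUI, hRI, -, hN⟩ ⟨m', N', mR', MR', hUI', hRI', -, hN'⟩
    obtain ⟨-, rfl⟩ := hRI.eq_of_isRegion hR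
    obtain ⟨-, rfl⟩ := hRI'.eq_of_isRegion hR'
    obtain ⟨-, rfl⟩ := hUI.unique hB hBpos hU hUI'
    obtain ⟨S, hS, hUS⟩ := hU.exists_isRegion_superset
    have hNM := hMmax N hUI.2.1 hN hN'
    exact ⟨m, N, M, M, hUI, isFacialInterval_self hB hBpos hM,
      Set.Subset.trans (hUI.min_le_max hS hUS) hNM, hNM⟩
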